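/- arXiv:math/0512027 — 3 statements merged into one kernel-verified Lean document; each statement's English description precedes it below -/
import Mathlib

section
/- Let d ≥ 1. For every (s_1,…,s_d) ∈ ℂ^d in the region (R), the infinite product over all monic irreducible polynomials P in F_q[T] of the factors ∏_{k=1}^d (1 − |P|^{−(s_k+⋯+s_d−(d−k))})^{-1} is multipliable (converges), and Z_d(F_q[T]; s_1,…,s_d) = ∏_{P monic irreducible} ∏_{k=1}^d (1 − |P|^{−(s_k+⋯+s_d−(d−k))})^{-1}. -/
open Polynomial Filter Topology

namespace MZ

lemma fiber {X ι : Type*} (D : X → ι) (c : ι → ℕ) (hf : ∀ i, Finite {x // D x = i})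
    (hc : ∀ i, Nat.card {x // D x = i} = c i) (H : ι → ℂ)
    (hsum : Summable fun i => ‖(c i : ℂ) * H i‖) :
    Summable (fun x => ‖H (D x)‖) ∧ HasSum (fun x => H (D x)) (∑' i, (c i : ℂ) * H i) := by
  have hS : Summable (fun x => ‖H (D x)‖) := by
    rw [← (Equiv.sigmaFiberEquiv D).summable_iff]
    rw [summable_sigma_of_nonneg (fun _ => by simp only [Function.comp]; exact norm_nonneg _)]
    constructor
    · intro i
      have := hf i
      exact Summable.of_finite
    · refine hsum.congr fun i => ?_
      have := hf i
      have := Fintype.ofFinite {x // D x = i}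
      have : ∀ y : {x // D x = i}, D y.1 = i := fun y => y.2
      simp only [Function.comp, Equiv.sigmaFiberEquiv, Equiv.coe_fn_mk, this]
      rw [tsum_fintype, Finset.sum_const, Finset.card_univ, ← Nat.card_eq_fintype_card, hc]
      simp
  refine ⟨hS, ?_⟩
  have h1 : HasSum (fun x => H (D x)) (∑' x, H (D x)) := hS.of_norm.hasSum
  have h2 := h1
  rw [← (Equiv.sigmaFiberEquiv D).hasSum_iff] at h2
  have h3 := h2.sigma (g := fun i => (c i : ℂ) * H i) (fun i => by
      have := hf i
      have := Fintype.ofFinite {x // D x = i}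
      have : ∀ y : {x // D x = i}, D y.1 = i := fun y => y.2
      simp only [Function.comp, Equiv.sigmaFiberEquiv, Equiv.coe_fn_mk, this]
      have := hasSum_fintype (fun _ : {x // D x = i} => H i)
      rwa [Finset.sum_const, Finset.card_univ, ← Nat.card_eq_fintype_card, hc, nsmul_eq_mul] at this)
  rw [h3.tsum_eq]
  exact h1

variable {F : Type*} [Field F] [Fintype F]

lemma finite_monic (n : ℕ) : Finite {p : F[X] // p.Monic ∧ p.natDegree = n} :=
  Finite.of_equiv _ ((monicEquivDegreeLT n).trans (degreeLTEquiv F n).toEquiv).symm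

lemma card_monic (n : ℕ) :
    Nat.card {p : F[X] // p.Monic ∧ p.natDegree = n} = Fintype.card F ^ n := by
  rw [Nat.card_congr ((monicEquivDegreeLT n).trans (degreeLTEquiv F n).toEquiv)]
  simp

open Classical in
/-- the completely multiplicative weight -/
noncomputable def g (x : ℂ) (f : F[X]) : ℂ := if f.Monic then x ^ f.natDegree else 0

open Classical in
lemma g_sum (x : ℂ) (hx : ‖(Fintype.card F : ℂ) * x‖ < 1) :
    Summable (fun f : F[X] => ‖g x f‖) ∧ HasSum (g x : F[X] → ℂ) (1 - Fintype.card F * x)⁻¹ := by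
  have e : ∀ n, {y : {p : F[X] // p.Monic} // y.1.natDegree = n} ≃
      {p : F[X] // p.Monic ∧ p.natDegree = n} := fun n =>
    Equiv.subtypeSubtypeEquivSubtypeInter (fun p : F[X] => p.Monic) (fun p => p.natDegree = n)
  have h0 : ∀ n : ℕ, (((Fintype.card F ^ n : ℕ) : ℂ) * x ^ n) = ((Fintype.card F : ℂ) * x) ^ n := by
    intro n; push_cast; rw [mul_pow]
  obtain ⟨h1, h2⟩ := fiber (fun f : {p : F[X] // p.Monic} => f.1.natDegree)
    (fun n => Fintype.card F ^ n)
    (fun n => by have := finite_monic (F := F) n; exact Finite.of_equiv _ (e n).symm)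
    (fun n => by rw [Nat.card_congr (e n), card_monic]) (fun n => x ^ n)
    (by simp_rw [h0, norm_pow]; exact summable_geometric_of_lt_one (norm_nonneg _) hx)
  simp_rw [h0] at h2
  rw [tsum_geometric_of_norm_lt_one hx] at h2
  have hinj : Function.Injective (Subtype.val : {p : F[X] // p.Monic} → F[X]) :=
    Subtype.val_injective
  constructor
  · rw [← hinj.summable_iff]
    · refine h1.congr fun f => ?_
      simp [g, f.2]
    · intro f hf
      have : ¬ f.Monic := by simpa using hf
      simp [g, this]
  · rw [← hinj.hasSum_iff]
    · convert h2 using 2 with f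
      simp [g, f.2]
    · intro f hf
      have : ¬ f.Monic := by simpa using hf
      simp [g, this]

/-- monic irreducibles -/
abbrev Pr (F : Type*) [Field F] := {P : F[X] // P.Monic ∧ Irreducible P}

lemma g_mul (x : ℂ) {P : F[X]} (hP : P.Monic) (f : F[X]) :
    g x (P * f) = x ^ P.natDegree * g x f := by
  unfold g
  by_cases hf : f.Monic
  · rw [if_pos hf, if_pos (hP.mul hf), hP.natDegree_mul hf, pow_add]
  · rw [if_neg hf, if_neg, mul_zero]
    intro h
    exact hf (hP.of_mul_monic_left h)

open Classical in
/-- sieved weight -/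
noncomputable def A (x : ℂ) (S : Finset (Pr F)) (f : F[X]) : ℂ :=
  if ∀ P ∈ S, ¬ P.1 ∣ f then g x f else 0

lemma A_le (x : ℂ) (S : Finset (Pr F)) (f : F[X]) : ‖A x S f‖ ≤ ‖g x f‖ := by
  unfold A; split_ifs <;> simp

lemma A_insert (x : ℂ) (hs : Summable (fun f : F[X] => ‖g x f‖)) [DecidableEq (Pr F)]
    (S : Finset (Pr F)) (P : Pr F) (hP : P ∉ S) :
    ∑' f, A x (insert P S) f = (1 - x ^ P.1.natDegree) * ∑' f, A x S f := by
  classical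
  have hA : ∀ S : Finset (Pr F), Summable (A x S) := fun S =>
    (Summable.of_nonneg_of_le (fun _ => norm_nonneg _) (A_le x S) hs).of_norm
  have hinj : Function.Injective (fun f : F[X] => P.1 * f) :=
    mul_right_injective₀ P.2.1.ne_zero
  have key : ∑' f, (A x S f - A x (insert P S) f) = x ^ P.1.natDegree * ∑' f, A x S f := by
    rw [← tsum_mul_left, ← hinj.tsum_eq]
    · refine tsum_congr fun f => ?_
      have h1 : A x (insert P S) (P.1 * f) = 0 := by
        unfold A; rw [if_neg]; push Not
        exact ⟨P, Finset.mem_insert_self _ _, dvd_mul_right _ _⟩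
      rw [h1, sub_zero]
      unfold A
      have h2 : (∀ Q ∈ S, ¬ Q.1 ∣ P.1 * f) ↔ (∀ Q ∈ S, ¬ Q.1 ∣ f) := by
        refine forall₂_congr fun Q hQ => not_congr ?_
        constructor
        · intro h
          rcases Q.2.2.prime.dvd_or_dvd h with h | h
          · exfalso
            apply hP
            have : Q = P := Subtype.ext (eq_of_monic_of_associated Q.2.1 P.2.1
              (Q.2.2.associated_of_dvd P.2.2 h))
            rwa [← this]
          · exact h
        · intro h; exact h.mul_left _
      simp only [h2, g_mul x P.2.1]
      split_ifs <;> simp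
    · intro f hf
      by_contra hn
      apply hf
      have : ¬ P.1 ∣ f := fun ⟨h, hh⟩ => hn ⟨h, hh.symm⟩
      simp [A, this]
  rw [(hA S).tsum_sub (hA _)] at key
  linear_combination -key

lemma A_prod (x : ℂ) (hs : Summable (fun f : F[X] => ‖g x f‖)) (S : Finset (Pr F)) :
    ∑' f, A x S f = (∏ P ∈ S, (1 - x ^ P.1.natDegree)) * ∑' f : F[X], g x f := by
  classical
  induction S using Finset.induction_on with
  | empty => simp [A]
  | insert P S hP ih => rw [A_insert x hs S P hP, ih, Finset.prod_insert hP]; ring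

lemma A_tendsto (x : ℂ) (hs : Summable (fun f : F[X] => ‖g x f‖)) :
    Tendsto (fun S : Finset (Pr F) => ∑' f, A x S f) atTop (𝓝 1) := by
  classical
  have : (1 : ℂ) = ∑' f : F[X], if f = 1 then 1 else 0 := by simp
  rw [this]
  refine tendsto_tsum_of_dominated_convergence hs (fun f => ?_)
    (Eventually.of_forall fun S f => A_le x S f)
  by_cases hf : f.Monic
  · by_cases h1 : f = 1
    · subst h1
      refine tendsto_const_nhds.congr fun S => ?_
      rw [if_pos rfl, A, if_pos]
      · simp [g]
      · intro P _ h
        exact P.2.2.not_isUnit (isUnit_of_dvd_one h)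
    · have hu : ¬ IsUnit f := fun h => h1 (hf.eq_one_of_isUnit h)
      obtain ⟨P, hPmo, hPi, hd⟩ := exists_monic_irreducible_factor f hu
      refine tendsto_const_nhds.congr' ?_
      filter_upwards [eventually_ge_atTop {(⟨P, hPmo, hPi⟩ : Pr F)}] with S hS
      rw [if_neg h1, A, if_neg]
      intro h
      exact h ⟨P, hPmo, hPi⟩ (hS (Finset.mem_singleton_self _)) hd
  · have h1 : f ≠ 1 := by rintro rfl; exact hf monic_one
    refine tendsto_const_nhds.congr fun S => ?_
    simp [A, g, hf, h1]

lemma euler (x : ℂ) (hx : ‖(Fintype.card F : ℂ) * x‖ < 1) :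
    HasProd (fun P : Pr F => (1 - x ^ P.1.natDegree)⁻¹) (1 - Fintype.card F * x)⁻¹ := by
  obtain ⟨hs, hg⟩ := g_sum (F := F) x hx
  have hx1 : ‖x‖ < 1 := by
    refine lt_of_le_of_lt ?_ hx
    rw [norm_mul]
    have : (1 : ℝ) ≤ ‖(Fintype.card F : ℂ)‖ := by
      simp only [Complex.norm_natCast]
      exact_mod_cast Fintype.card_pos
    nlinarith [norm_nonneg x]
  have hne : ∀ P : Pr F, 1 - x ^ P.1.natDegree ≠ 0 := by
    intro P h
    have : ‖x ^ P.1.natDegree‖ < 1 := by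
      rw [norm_pow]
      exact pow_lt_one₀ (norm_nonneg _) hx1 P.2.2.natDegree_pos.ne'
    rw [← sub_eq_zero.1 h] at this
    simp at this
  have h := A_tendsto (F := F) x hs
  have h' := (h.inv₀ one_ne_zero).mul_const (1 - Fintype.card F * x)⁻¹
  rw [inv_one, one_mul] at h'
  refine h'.congr fun S => ?_
  have hz : (1 - Fintype.card F * x)⁻¹ ≠ 0 := by
    apply inv_ne_zero
    intro h
    rw [← sub_eq_zero.1 h] at hx
    simp at hx
  have hp : ∏ P ∈ S, (1 - x ^ P.1.natDegree) ≠ 0 := Finset.prod_ne_zero_iff.2 fun P _ => hne P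
  rw [A_prod x hs, hg.tsum_eq, Finset.prod_inv_distrib, mul_inv, mul_assoc, inv_mul_cancel₀ hz,
    mul_one]

lemma pi_geom (d : ℕ) (y : Fin d → ℂ) (hy : ∀ k, ‖y k‖ < 1) :
    Summable (fun m : Fin d → ℕ => ‖∏ k, y k ^ m k‖) ∧
    ∑' m : Fin d → ℕ, ∏ k, y k ^ m k = ∏ k, (1 - y k)⁻¹ := by
  induction d with
  | zero => exact ⟨Summable.of_finite, by simp⟩
  | succ d ih =>
    obtain ⟨h1, h2⟩ := ih (fun k => y k.succ) (fun k => hy _)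
    have h3 : Summable (fun n : ℕ => ‖y 0 ^ n‖) := by
      simp_rw [norm_pow]; exact summable_geometric_of_lt_one (norm_nonneg _) (hy 0)
    have hE : ∀ z : ℕ × (Fin d → ℕ), ∏ k, y k ^ (Fin.consEquiv (fun _ => ℕ) z k) =
        y 0 ^ z.1 * ∏ k : Fin d, y k.succ ^ z.2 k := by
      intro z; rw [Fin.prod_univ_succ]; simp [Fin.consEquiv]
    constructor
    · rw [← (Fin.consEquiv (fun _ : Fin (d+1) => ℕ)).summable_iff]
      have := h3.mul_norm h1
      refine this.congr fun z => ?_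
      rw [Function.comp_apply, hE]
    · rw [← (Fin.consEquiv (fun _ : Fin (d+1) => ℕ)).tsum_eq]
      simp_rw [hE]
      rw [← tsum_mul_tsum_of_summable_norm h3 h1, h2, tsum_geometric_of_norm_lt_one (hy 0),
        Fin.prod_univ_succ]

/-- partial sums -/
def ps (d : ℕ) (m : Fin d → ℕ) : {n : Fin d → ℕ // Monotone n} :=
  ⟨fun k => ∑ j ∈ Finset.Iic k, m j, fun _ _ h =>
    Finset.sum_le_sum_of_subset (Finset.Iic_subset_Iic.2 h)⟩

lemma ps_rec (d : ℕ) (m : Fin d → ℕ) (k : ℕ) (hk : k + 1 < d) :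
    (ps d m).1 ⟨k + 1, hk⟩ = (ps d m).1 ⟨k, by omega⟩ + m ⟨k + 1, hk⟩ := by
  have : (Finset.Iic (⟨k + 1, hk⟩ : Fin d)) =
      insert ⟨k + 1, hk⟩ (Finset.Iic (⟨k, by omega⟩ : Fin d)) := by
    ext j
    simp only [Finset.mem_Iic, Finset.mem_insert, Fin.le_def, Fin.ext_iff]
    omega
  simp only [ps]
  rw [this, Finset.sum_insert (by simp [Fin.le_def]), add_comm]

lemma ps_zero (d : ℕ) (m : Fin d → ℕ) (hk : 0 < d) :
    (ps d m).1 ⟨0, hk⟩ = m ⟨0, hk⟩ := by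
  have : (Finset.Iic (⟨0, hk⟩ : Fin d)) = {⟨0, hk⟩} := by
    ext j
    simp only [Finset.mem_Iic, Finset.mem_singleton, Fin.le_def, Fin.ext_iff]
    omega
  simp only [ps]
  rw [this, Finset.sum_singleton]

lemma ps_bij (d : ℕ) : Function.Bijective (ps d) := by
  constructor
  · intro m m' h
    funext ⟨k, hk⟩
    cases k with
    | zero => rw [← ps_zero d m hk, ← ps_zero d m' hk, h]
    | succ k =>
      have h1 := ps_rec d m k hk
      have h2 := ps_rec d m' k hk
      rw [h] at h1
      omega
  · rintro ⟨n, hn⟩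
    refine ⟨fun k => n k - if h : 0 < k.1 then n ⟨k.1 - 1, by omega⟩ else 0, ?_⟩
    apply Subtype.ext
    funext ⟨k, hk⟩
    induction k with
    | zero => rw [ps_zero]; simp
    | succ k ih =>
      rw [ps_rec, ih]
      have : n ⟨k, by omega⟩ ≤ n ⟨k + 1, hk⟩ := hn (by simp [Fin.le_def])
      simp
      omega

lemma mono_geom (d : ℕ) (b : Fin d → ℂ) (hy : ∀ k, ‖∏ j ∈ Finset.Ici k, b j‖ < 1) :
    Summable (fun n : {n : Fin d → ℕ // Monotone n} => ‖∏ k, b k ^ n.1 k‖) ∧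
    ∑' n : {n : Fin d → ℕ // Monotone n}, ∏ k, b k ^ n.1 k =
      ∏ k, (1 - ∏ j ∈ Finset.Ici k, b j)⁻¹ := by
  obtain ⟨h1, h2⟩ := pi_geom d (fun k => ∏ j ∈ Finset.Ici k, b j) hy
  have hE : ∀ m : Fin d → ℕ, ∏ k, b k ^ (ps d m).1 k =
      ∏ k, (∏ j ∈ Finset.Ici k, b j) ^ m k := by
    intro m
    simp only [ps, ← Finset.prod_pow_eq_pow_sum, ← Finset.prod_pow]
    apply Finset.prod_comm'
    simp
  let e := Equiv.ofBijective _ (ps_bij d)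
  have he : ∀ m, e m = ps d m := fun m => rfl
  constructor
  · rw [← e.summable_iff]
    refine h1.congr fun m => ?_
    rw [Function.comp_apply, he, hE]
  · rw [← e.tsum_eq, ← h2]
    refine tsum_congr fun m => ?_
    rw [he, hE]

lemma zeta_sum (d : ℕ) (a : Fin d → ℂ)
    (hy : ∀ k, ‖∏ j ∈ Finset.Ici k, ((Fintype.card F : ℂ) * a j)‖ < 1) :
    ∑' f : {f : Fin d → F[X] // (∀ k, (f k).Monic) ∧ Monotone fun k => (f k).natDegree},
      ∏ k, a k ^ (f.1 k).natDegree =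
      ∏ k, (1 - ∏ j ∈ Finset.Ici k, ((Fintype.card F : ℂ) * a j))⁻¹ := by
  obtain ⟨h1, h2⟩ := mono_geom d _ hy
  have e : ∀ n : {n : Fin d → ℕ // Monotone n},
      {f : {f : Fin d → F[X] // (∀ k, (f k).Monic) ∧ Monotone fun k => (f k).natDegree} //
        (⟨fun k => (f.1 k).natDegree, f.2.2⟩ : {n : Fin d → ℕ // Monotone n}) = n} ≃
      (∀ k, {p : F[X] // p.Monic ∧ p.natDegree = n.1 k}) := fun n =>
    { toFun := fun f k => ⟨f.1.1 k, f.1.2.1 k, congrFun (congrArg Subtype.val f.2) k⟩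
      invFun := fun f => ⟨⟨fun k => (f k).1, fun k => (f k).2.1, by
        have : (fun k => (f k).1.natDegree) = n.1 := funext fun k => (f k).2.2
        rw [this]; exact n.2⟩, Subtype.ext (funext fun k => (f k).2.2)⟩
      left_inv := fun f => rfl
      right_inv := fun f => rfl }
  have h0 : ∀ n : {n : Fin d → ℕ // Monotone n},
      ((∏ k, Fintype.card F ^ n.1 k : ℕ) : ℂ) * ∏ k, a k ^ n.1 k =
      ∏ k, ((Fintype.card F : ℂ) * a k) ^ n.1 k := by
    intro n; push_cast; rw [← Finset.prod_mul_distrib]; simp_rw [mul_pow]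
  have := (fiber (fun f : {f : Fin d → F[X] //
      (∀ k, (f k).Monic) ∧ Monotone fun k => (f k).natDegree} =>
      (⟨fun k => (f.1 k).natDegree, f.2.2⟩ : {n : Fin d → ℕ // Monotone n}))
    (fun n => ∏ k, Fintype.card F ^ n.1 k)
    (fun n => by
      have := fun k => finite_monic (F := F) (n.1 k)
      exact Finite.of_equiv _ (e n).symm)
    (fun n => by rw [Nat.card_congr (e n), Nat.card_pi]; simp_rw [card_monic])
    (fun n => ∏ k, a k ^ n.1 k)
    (by simp_rw [h0]; exact h1)).2.tsum_eq
  simp_rw [h0] at this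
  rw [h2] at this
  exact this

lemma cpow_swap (q : ℕ) (n : ℕ) (w : ℂ) :
    ((q : ℂ) ^ n : ℂ) ^ w = ((q : ℂ) ^ w) ^ n := by
  induction n with
  | zero => simp
  | succ n ih =>
    rw [pow_succ, pow_succ, ← ih, ← Nat.cast_pow, Complex.natCast_mul_natCast_cpow]

lemma cpow_sum {ι : Type*} (q : ℂ) (hq : q ≠ 0) (S : Finset ι) (w : ι → ℂ) :
    q ^ (∑ j ∈ S, w j) = ∏ j ∈ S, q ^ w j := by
  classical
  induction S using Finset.induction_on with
  | empty => simp
  | insert a S ha ih => rw [Finset.sum_insert ha, Finset.prod_insert ha, Complex.cpow_add _ _ hq, ih]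

end MZ


/-- On the region (R), the Euler product over monic irreducible
polynomials `P` of `∏_{k=1}^d (1 − |P|^{−(s_k+⋯+s_d−(d−k))})⁻¹` is multipliable,
and it equals `Z_d(F_q[T]; s_1,…,s_d)`. -/
theorem multiple_zeta_FqT_euler_product
    (F : Type*) [Field F] [Fintype F] (d : ℕ) (hd : 1 ≤ d)
    (s : Fin d → ℂ)
    (hs : ∀ k : Fin d, (d : ℝ) - (k.val : ℝ) < (∑ j ∈ Finset.Ici k, s j).re) :
    Multipliable (fun P : {P : Polynomial F // P.Monic ∧ Irreducible P} =>
      ∏ k : Fin d,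
        (1 - ((Fintype.card F : ℂ) ^ P.1.natDegree : ℂ) ^
          (-((∑ j ∈ Finset.Ici k, s j) - ((d : ℂ) - 1 - (k.val : ℂ)))))⁻¹) ∧
    (∑' f : {f : Fin d → Polynomial F //
        (∀ k, (f k).Monic) ∧ Monotone fun k => (f k).natDegree},
      ∏ k : Fin d, ((Fintype.card F : ℂ) ^ (f.1 k).natDegree : ℂ) ^ (-(s k))) =
    ∏' P : {P : Polynomial F // P.Monic ∧ Irreducible P},
      ∏ k : Fin d,
        (1 - ((Fintype.card F : ℂ) ^ P.1.natDegree : ℂ) ^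
          (-((∑ j ∈ Finset.Ici k, s j) - ((d : ℂ) - 1 - (k.val : ℂ)))))⁻¹ := by
  have hq : 1 < Fintype.card F := Fintype.one_lt_card
  have hq0 : (Fintype.card F : ℂ) ≠ 0 := by exact_mod_cast (by omega)
  set q := Fintype.card F with hqdef
  have hprod : ∀ k : Fin d, ∏ j ∈ Finset.Ici k, ((q : ℂ) * (q : ℂ) ^ (-(s j))) =
      (q : ℂ) * (q : ℂ) ^ (-((∑ j ∈ Finset.Ici k, s j) - ((d : ℂ) - 1 - (k.val : ℂ)))) := by
    intro k
    have h1 : ∀ w : ℂ, (q : ℂ) * (q : ℂ) ^ w = (q : ℂ) ^ (1 + w) := by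
      intro w; rw [Complex.cpow_add _ _ hq0, Complex.cpow_one]
    simp_rw [h1]
    rw [← MZ.cpow_sum _ hq0]
    congr 1
    rw [Finset.sum_add_distrib, Finset.sum_neg_distrib, Finset.sum_const, Fin.card_Ici,
      nsmul_eq_mul, Nat.cast_sub k.2.le]
    ring
  have hy : ∀ k : Fin d, ‖(q : ℂ) *
      (q : ℂ) ^ (-((∑ j ∈ Finset.Ici k, s j) - ((d : ℂ) - 1 - (k.val : ℂ))))‖ < 1 := by
    intro k
    have h1 : ∀ w : ℂ, (q : ℂ) * (q : ℂ) ^ w = (q : ℂ) ^ (1 + w) := by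
      intro w; rw [Complex.cpow_add _ _ hq0, Complex.cpow_one]
    rw [h1, Complex.norm_natCast_cpow_of_pos (by omega)]
    apply Real.rpow_lt_one_of_one_lt_of_neg (by exact_mod_cast hq)
    have := hs k
    simp only [Complex.add_re, Complex.one_re, Complex.neg_re, Complex.sub_re, Complex.natCast_re]
    linarith
  simp only [MZ.cpow_swap]
  have hE := hasProd_prod (s := Finset.univ) (fun k _ => MZ.euler (F := F) _ (hy k))
  refine ⟨hE.multipliable, ?_⟩
  rw [hE.tprod_eq, MZ.zeta_sum (F := F) d _ (fun k => by rw [hprod k]; exact hy k)]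
  exact Finset.prod_congr rfl fun k _ => by rw [hprod k]
end

section
/- Let d ≥ 1. For every (s_1,…,s_d) ∈ ℂ^d in the region (R), the multiple zeta function factors as Z_d(F_q[T]; s_1,…,s_d) = ∏_{k=1}^d Z(F_q[T], s_k+⋯+s_d−(d−k)), where for each k the one-variable series Z(F_q[T], s_k+⋯+s_d−(d−k)) = Σ_{f monic} |f|^{−(s_k+⋯+s_d−(d−k))} converges absolutely (since Re(s_k+⋯+s_d−(d−k)) > 1 on (R)). -/
lemma mz_sigma {α : Type*} (β : α → Type*) [∀ a, Finite (β a)] (g : α → ℂ)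
    (h : Summable fun a => ‖(Nat.card (β a) : ℂ) * g a‖) :
    (Summable fun x : (Σ a, β a) => ‖g x.1‖) ∧
    ∑' x : (Σ a, β a), g x.1 = ∑' a, (Nat.card (β a) : ℂ) * g a := by
  have h1 : Summable fun x : (Σ a, β a) => ‖g x.1‖ := by
    rw [summable_sigma_of_nonneg (fun x => norm_nonneg _)]
    refine ⟨fun a => ?_, ?_⟩
    · have := Fintype.ofFinite (β a)
      exact (hasSum_fintype _).summable
    · convert h using 2 with a
      have := Fintype.ofFinite (β a)
      simp [tsum_fintype, Nat.card_eq_fintype_card]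
  refine ⟨h1, ?_⟩
  rw [h1.of_norm.tsum_sigma]
  congr 1
  ext a
  have := Fintype.ofFinite (β a)
  simp [tsum_fintype, Nat.card_eq_fintype_card]

lemma mz_pi (d : ℕ) (x : Fin d → ℂ) (hx : ∀ k, ‖x k‖ < 1) :
    (Summable fun a : Fin d → ℕ => ‖∏ k, x k ^ a k‖) ∧
    ∑' a : Fin d → ℕ, ∏ k, x k ^ a k = ∏ k, ∑' n : ℕ, x k ^ n := by
  induction d with
  | zero => exact ⟨(hasSum_fintype _).summable, by simp⟩
  | succ d ih =>
    obtain ⟨i1, i2⟩ := ih (fun k => x k.succ) (fun k => hx _)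
    have h0 : Summable fun n : ℕ => ‖x 0 ^ n‖ := by
      simpa using summable_geometric_of_lt_one (norm_nonneg _) (hx 0)
    let e : ℕ × (Fin d → ℕ) ≃ (Fin (d+1) → ℕ) := Fin.consEquiv (fun _ => ℕ)
    have he : ∀ p : ℕ × (Fin d → ℕ), ∏ k, x k ^ (e p k) = x 0 ^ p.1 * ∏ k : Fin d, x k.succ ^ p.2 k := by
      intro p
      simp [e, Fin.prod_univ_succ, Fin.consEquiv]
    constructor
    · rw [← e.summable_iff]
      have := h0.mul_norm i1
      refine this.congr fun p => ?_
      simp only [Function.comp, he]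
    · rw [← e.tsum_eq, Fin.prod_univ_succ, ← i2, tsum_mul_tsum_of_summable_norm h0 i1]
      simp only [he]

lemma mz_bij (d : ℕ) : Function.Bijective (fun a : Fin d → ℕ =>
    (⟨fun k => ∑ j ∈ Finset.Iic k, a j, fun k l h => 
      Finset.sum_le_sum_of_subset (Finset.Iic_subset_Iic.2 h)⟩ : {n : Fin d → ℕ // Monotone n})) := by
  have key : ∀ (a : Fin d → ℕ) (k : Fin d), ∑ j ∈ Finset.Iic k, a j = a k + ∑ j ∈ Finset.Iio k, a j := by
    intro a k
    rw [← Finset.Iio_insert, Finset.sum_insert (by simp)]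
  constructor
  · intro a b h
    have h' : ∀ k, ∑ j ∈ Finset.Iic k, a j = ∑ j ∈ Finset.Iic k, b j := fun k => 
      congrFun (congrArg Subtype.val h) k
    ext k
    induction k using WellFoundedLT.induction with
    | ind k ih =>
      have := h' k
      rw [key, key, Finset.sum_congr rfl (fun j hj => ih j (Finset.mem_Iio.1 hj))] at this
      exact Nat.add_right_cancel this
  · rintro ⟨n, hn⟩
    let a : Fin d → ℕ := fun k => n k - if k.val = 0 then 0 else n ⟨k.val - 1, by omega⟩
    refine ⟨a, Subtype.ext (funext fun k => ?_)⟩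
    show ∑ j ∈ Finset.Iic k, a j = n k
    obtain ⟨k, hk⟩ := k
    induction k with
    | zero =>
      rw [key]
      have : Finset.Iio (⟨0, hk⟩ : Fin d) = ∅ := by
        ext j; simp [Fin.lt_def]
      simp [this, a]
    | succ k ih =>
      rw [key]
      have : Finset.Iio (⟨k+1, hk⟩ : Fin d) = Finset.Iic ⟨k, by omega⟩ := by
        ext j; simp [Fin.lt_def, Fin.le_def]
      rw [this, ih]
      have := @hn ⟨k, by omega⟩ ⟨k+1, hk⟩ (by simp [Fin.le_def])
      simp [a]
      omega

lemma mz_reindex {d : ℕ} (c : Fin d → ℂ) (a : Fin d → ℕ) :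
    ∏ k, c k ^ (∑ j ∈ Finset.Iic k, a j) = ∏ j, (∏ k ∈ Finset.Ici j, c k) ^ a j := by
  simp only [← Finset.prod_pow_eq_pow_sum, ← Finset.prod_pow]
  exact Finset.prod_comm' (by simp)

abbrev MzM (F : Type*) [Field F] (n : ℕ) := {f : Polynomial F // f.Monic ∧ f.natDegree = n}

noncomputable def mzEquiv (F : Type*) [Field F] (n : ℕ) : MzM F n ≃ (Fin n → F) :=
  (Polynomial.monicEquivDegreeLT n).trans (Polynomial.degreeLTEquiv F n).toEquiv

instance mzFinite (F : Type*) [Field F] [Fintype F] (n : ℕ) : Finite (MzM F n) :=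
  Finite.of_equiv _ (mzEquiv F n).symm

lemma mz_card (F : Type*) [Field F] [Fintype F] (n : ℕ) :
    Nat.card (MzM F n) = Fintype.card F ^ n := by
  rw [Nat.card_congr (mzEquiv F n)]; simp

/-- Monic polynomials grouped by degree. -/
def mzE1 (F : Type*) [Field F] : (Σ n, MzM F n) ≃ {f : Polynomial F // f.Monic} where
  toFun x := ⟨x.2.1, x.2.2.1⟩
  invFun f := ⟨f.1.natDegree, f.1, f.2, rfl⟩
  left_inv := by rintro ⟨n, f, hf, rfl⟩; rfl
  right_inv _ := rfl

/-- Tuples of monic polynomials grouped by degrees. -/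
def mzEd (F : Type*) [Field F] (d : ℕ) :
    (Σ n : {n : Fin d → ℕ // Monotone n}, ∀ k, MzM F (n.1 k)) ≃
    {f : Fin d → Polynomial F // (∀ k, (f k).Monic) ∧ Monotone fun k => (f k).natDegree} where
  toFun x := ⟨fun k => (x.2 k).1, fun k => (x.2 k).2.1, by
    simpa only [(x.2 _).2.2] using x.1.2⟩
  invFun f := ⟨⟨fun k => (f.1 k).natDegree, f.2.2⟩, fun k => ⟨f.1 k, f.2.1 k, rfl⟩⟩
  left_inv := by
    rintro ⟨⟨n, hn⟩, f⟩
    have key : ∀ (m : Fin d → ℕ) (hm : Monotone m) (g : ∀ k, MzM F (m k)), m = n →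
        (∀ k, (g k).1 = (f k).1) →
        (⟨⟨m, hm⟩, g⟩ : Σ n : {n : Fin d → ℕ // Monotone n}, ∀ k, MzM F (n.1 k)) =
          ⟨⟨n, hn⟩, f⟩ := by
      intro m hm g h hg
      subst h
      have : g = f := funext fun k => Subtype.ext (hg k)
      rw [this]
    exact key _ _ _ (funext fun k => (f k).2.2) (fun k => rfl)
  right_inv _ := rfl

lemma mz_cpow (q n : ℕ) (z : ℂ) : ((q : ℂ) ^ n) ^ z = ((q : ℂ) ^ z) ^ n := by
  rw [← Complex.natCast_cpow_natCast_mul, Complex.cpow_nat_mul]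

lemma mz_one (F : Type*) [Field F] [Fintype F] (z : ℂ)
    (hx : ‖(Fintype.card F : ℂ) * (Fintype.card F : ℂ) ^ z‖ < 1) :
    (Summable fun f : {f : Polynomial F // f.Monic} =>
      ‖((Fintype.card F : ℂ) ^ f.1.natDegree : ℂ) ^ z‖) ∧
    ∑' f : {f : Polynomial F // f.Monic}, ((Fintype.card F : ℂ) ^ f.1.natDegree : ℂ) ^ z =
      ∑' n : ℕ, ((Fintype.card F : ℂ) * (Fintype.card F : ℂ) ^ z) ^ n := by
  have hg : ∀ n, (Nat.card (MzM F n) : ℂ) * ((Fintype.card F : ℂ) ^ n) ^ z = 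
     ((Fintype.card F : ℂ) * (Fintype.card F : ℂ) ^ z) ^ n := by
    intro n
    rw [mz_card, mz_cpow, mul_pow]; push_cast; rfl
  have := mz_sigma (MzM F) (fun n => ((Fintype.card F : ℂ) ^ n) ^ z) (by
    simp only [hg, norm_pow]
    exact summable_geometric_of_lt_one (norm_nonneg _) hx)
  simp only [hg] at this
  rw [← (mzE1 F).summable_iff, ← (mzE1 F).tsum_eq, ← this.2]
  constructor
  · refine this.1.congr fun x => ?_
    simp [mzE1, x.2.2.2]
  · refine tsum_congr fun x => ?_
    simp [mzE1, x.2.2.2]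

lemma mz_multi (F : Type*) [Field F] [Fintype F] (d : ℕ) (s : Fin d → ℂ)
    (hx : ∀ k, ‖∏ j ∈ Finset.Ici k, ((Fintype.card F : ℂ) * (Fintype.card F : ℂ) ^ (-(s j)))‖ < 1) :
    (∑' f : {f : Fin d → Polynomial F //
        (∀ k, (f k).Monic) ∧ Monotone fun k => (f k).natDegree},
      ∏ k : Fin d, ((Fintype.card F : ℂ) ^ (f.1 k).natDegree : ℂ) ^ (-(s k))) =
    ∏ k, ∑' n : ℕ, 
      (∏ j ∈ Finset.Ici k, ((Fintype.card F : ℂ) * (Fintype.card F : ℂ) ^ (-(s j)))) ^ n := by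
  obtain ⟨h1, h2⟩ := mz_pi d _ hx
  let e := Equiv.ofBijective _ (mz_bij d)
  let g : {n : Fin d → ℕ // Monotone n} → ℂ := fun n =>
    ∏ k : Fin d, ((Fintype.card F : ℂ) ^ (n.1 k) : ℂ) ^ (-(s k))
  have hg : ∀ n : {n : Fin d → ℕ // Monotone n}, 
      (Nat.card (∀ k, MzM F (n.1 k)) : ℂ) * g n =
      ∏ k, ((Fintype.card F : ℂ) * (Fintype.card F : ℂ) ^ (-(s k))) ^ n.1 k := by
    intro n
    rw [Nat.card_pi]
    push_cast
    rw [← Finset.prod_mul_distrib]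
    refine Finset.prod_congr rfl fun k _ => ?_
    rw [mz_card, mz_cpow, mul_pow]; push_cast; rfl
  have he : ∀ a, (Nat.card (∀ k, MzM F ((e a).1 k)) : ℂ) * g (e a) = 
      ∏ k, (∏ j ∈ Finset.Ici k, ((Fintype.card F : ℂ) * (Fintype.card F : ℂ) ^ (-(s j)))) ^ a k := by
    intro a
    rw [hg, ← mz_reindex]; rfl
  have := mz_sigma (fun n : {n : Fin d → ℕ // Monotone n} => ∀ k, MzM F (n.1 k)) g (by
    rw [← e.summable_iff]
    refine h1.congr fun a => ?_
    simp only [Function.comp, he])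
  rw [← h2, ← (mzEd F d).tsum_eq]
  trans ∑' x : (Σ n : {n : Fin d → ℕ // Monotone n}, ∀ k, MzM F (n.1 k)), g x.1
  · refine tsum_congr fun x => ?_
    simp [mzEd, g, (x.2 _).2.2]
  · rw [this.2, ← e.tsum_eq]
    exact tsum_congr he


/-- On the region (R), `Z_d(F_q[T]; s_1,…,s_d)` factors as
`∏_{k=1}^d Z(F_q[T], s_k+⋯+s_d−(d−k))`, where each one-variable series
`Z(F_q[T], s_k+⋯+s_d−(d−k)) = Σ_{f monic} |f|^{−(s_k+⋯+s_d−(d−k))}`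
converges absolutely. -/
theorem multiple_zeta_FqT_factorization
    (F : Type*) [Field F] [Fintype F] (d : ℕ) (hd : 1 ≤ d)
    (s : Fin d → ℂ)
    (hs : ∀ k : Fin d, (d : ℝ) - (k.val : ℝ) < (∑ j ∈ Finset.Ici k, s j).re) :
    (∀ k : Fin d, Summable fun f : {f : Polynomial F // f.Monic} =>
      ‖((Fintype.card F : ℂ) ^ f.1.natDegree : ℂ) ^
        (-((∑ j ∈ Finset.Ici k, s j) - ((d : ℂ) - 1 - (k.val : ℂ))))‖) ∧
    (∑' f : {f : Fin d → Polynomial F //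
        (∀ k, (f k).Monic) ∧ Monotone fun k => (f k).natDegree},
      ∏ k : Fin d, ((Fintype.card F : ℂ) ^ (f.1 k).natDegree : ℂ) ^ (-(s k))) =
    ∏ k : Fin d, ∑' f : {f : Polynomial F // f.Monic},
      ((Fintype.card F : ℂ) ^ f.1.natDegree : ℂ) ^
        (-((∑ j ∈ Finset.Ici k, s j) - ((d : ℂ) - 1 - (k.val : ℂ)))) := by
  have hq : 1 < Fintype.card F := Fintype.one_lt_card
  have hq0 : (Fintype.card F : ℂ) ≠ 0 := by
    exact_mod_cast (by omega : Fintype.card F ≠ 0)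
  have hprod : ∀ k : Fin d, 
      ∏ j ∈ Finset.Ici k, ((Fintype.card F : ℂ) * (Fintype.card F : ℂ) ^ (-(s j))) = 
      (Fintype.card F : ℂ) ^ ((d : ℂ) - (k.val : ℂ) - ∑ j ∈ Finset.Ici k, s j) := by
    intro k
    have hc : ((Finset.Ici k).card : ℂ) = (d : ℂ) - (k.val : ℂ) := by
      rw [Fin.card_Ici, Nat.cast_sub k.2.le]
    rw [Finset.prod_mul_distrib, Finset.prod_const, Complex.cpow_sub _ _ hq0, ← hc,
      Complex.cpow_natCast, div_eq_mul_inv, ← Complex.cpow_neg, ← Finset.sum_neg_distrib]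
    congr 1
    induction (Finset.Ici k) using Finset.induction_on with
    | empty => simp
    | insert a t ha ih => rw [Finset.prod_insert ha, Finset.sum_insert ha, ih, Complex.cpow_add _ _ hq0]
  have hone : ∀ k : Fin d, (Fintype.card F : ℂ) * (Fintype.card F : ℂ) ^
        (-((∑ j ∈ Finset.Ici k, s j) - ((d : ℂ) - 1 - (k.val : ℂ)))) = 
      (Fintype.card F : ℂ) ^ ((d : ℂ) - (k.val : ℂ) - ∑ j ∈ Finset.Ici k, s j) := by
    intro k
    nth_rw 1 [← Complex.cpow_one (Fintype.card F : ℂ)]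
    rw [← Complex.cpow_add _ _ hq0]
    congr 1
    ring
  have hlt : ∀ k : Fin d, 
      ‖(Fintype.card F : ℂ) ^ ((d : ℂ) - (k.val : ℂ) - ∑ j ∈ Finset.Ici k, s j)‖ < 1 := by
    intro k
    rw [Complex.norm_natCast_cpow_of_pos (by omega)]
    apply Real.rpow_lt_one_of_one_lt_of_neg (by exact_mod_cast hq)
    have := hs k
    simp only [Complex.sub_re, Complex.natCast_re]
    linarith
  refine ⟨fun k => (mz_one F _ (by rw [hone]; exact hlt k)).1, ?_⟩
  rw [mz_multi F d s (fun k => by rw [hprod]; exact hlt k)]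
  refine Finset.prod_congr rfl fun k _ => ?_
  rw [(mz_one F _ (by rw [hone]; exact hlt k)).2, hone, hprod]
end

section
/- For all (s, w) ∈ ℂ² such that q^{−(s−w)} ≠ 1, q^{1−(s−w)} ≠ 1, q^{−w} ≠ 1 and q^{1−w} ≠ 1, the completed double zeta function satisfies the functional relation ξ_2(F_q[T]; s, 1 − w) = ξ_2(F_q[T]; s − 2w + 1, w). -/
/-- The meromorphic continuation of the completed double zeta function over
`F_q[T]`: `ξ_2(F_q[T]; s, w) =
[q^{−(s+w−1)}/((1 − q^{−(s+w−1)})(1 − q^{2−(s+w)}))] ·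
[q^{−w}/((1 − q^{−w})(1 − q^{1−w}))]`. -/
noncomputable def xi2FqT (q : ℕ) (s w : ℂ) : ℂ :=
  ((q : ℂ) ^ (-(s + w - 1)) /
      ((1 - (q : ℂ) ^ (-(s + w - 1))) * (1 - (q : ℂ) ^ ((2 : ℂ) - (s + w))))) *
  ((q : ℂ) ^ (-w) /
      ((1 - (q : ℂ) ^ (-w)) * (1 - (q : ℂ) ^ (1 - w))))

/-- For `(s, w) ∈ ℂ²` with `q^{−(s−w)} ≠ 1`, `q^{1−(s−w)} ≠ 1`,
`q^{−w} ≠ 1` and `q^{1−w} ≠ 1`, one has the functional relation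
`ξ_2(F_q[T]; s, 1 − w) = ξ_2(F_q[T]; s − 2w + 1, w)`. -/
theorem xi2FqT_functional_relation
    (F : Type*) [Field F] [Fintype F] (s w : ℂ)
    (h1 : (Fintype.card F : ℂ) ^ (-(s - w)) ≠ 1)
    (h2 : (Fintype.card F : ℂ) ^ (1 - (s - w)) ≠ 1)
    (h3 : (Fintype.card F : ℂ) ^ (-w) ≠ 1)
    (h4 : (Fintype.card F : ℂ) ^ (1 - w) ≠ 1) :
    xi2FqT (Fintype.card F) s (1 - w) = xi2FqT (Fintype.card F) (s - 2 * w + 1) w := by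
  have hQ : (Fintype.card F : ℂ) ≠ 0 := by
    exact_mod_cast Fintype.card_ne_zero
  unfold xi2FqT
  generalize (Fintype.card F : ℕ) = q at *
  have e1 : -(s - 2 * w + 1 + w - 1) = -(s + (1 - w) - 1) := by ring
  have e2 : (2 : ℂ) - (s - 2 * w + 1 + w) = 2 - (s + (1 - w)) := by ring
  have e3 : -(1 - w) = w - 1 := by ring
  have e4 : 1 - (1 - w) = w := by ring
  rw [e1, e2, e3, e4]
  congr 1
  have hA : (q : ℂ) ^ w ≠ 0 := by
    rw [Complex.cpow_ne_zero_iff]; exact Or.inl hQ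
  rw [Complex.cpow_sub _ _ hQ, Complex.cpow_one] at h4
  rw [Complex.cpow_neg] at h3
  rw [Complex.cpow_sub _ _ hQ, Complex.cpow_sub _ _ hQ, Complex.cpow_one, Complex.cpow_neg]
  clear h1 h2
  generalize (q : ℂ) ^ w = A at *
  generalize (q : ℂ) = Q at *
  have a1 : A ≠ 1 := by
    rintro rfl; simp at h3
  have a2 : Q ≠ A := by
    rintro rfl; exact h4 (div_self hA)
  have b1 : 1 - A ≠ 0 := sub_ne_zero.mpr a1.symm
  have b2 : Q - A ≠ 0 := sub_ne_zero.mpr a2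
  have c1 : 1 - A / Q = (Q - A) / Q := by field_simp
  have c2 : 1 - A⁻¹ = -(1 - A) / A := by field_simp; ring
  have c3 : 1 - Q / A = -(Q - A) / A := by field_simp; ring
  rw [c1, c2, c3]
  field_simp
end
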